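/- arXiv:2404.00248 — 2 statements merged into one kernel-verified Lean document; each statement's English description precedes it below -/
import Mathlib

section
/- For every 0 < β < 1 and every t > 0, the Wright-type density g_β(·;t) is a probability density on [0,∞): ∫_0^∞ g_β(s;t) ds = 1. -/
open MeasureTheory Real Set Filter

/-- The Wright-type density `g_β(x;t) = t^{-β} ∑_{k} (−x/t^β)^k / (k! Γ(1 − β(k+1)))`. -/
noncomputable def wrightG (β x t : ℝ) : ℝ :=
  t ^ (-β) * ∑' k : ℕ, (-x / t ^ β) ^ k / ((Nat.factorial k : ℝ) * Real.Gamma (1 - β * (k + 1)))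

/-- The two-parameter Mittag-Leffler function `E_{β,α}(z) = ∑_k z^k / Γ(βk + α)`. -/
noncomputable def mittagLeffler (β α z : ℝ) : ℝ :=
  ∑' k : ℕ, z ^ k / Real.Gamma (β * k + α)

/-- The Caputo fractional derivative of order `β ∈ (0,1)`:
`D_c^β h(t) = (1/Γ(1−β)) ∫_0^t (t−τ)^{−β} h′(τ) dτ`. -/
noncomputable def caputo (β : ℝ) (h : ℝ → ℝ) (t : ℝ) : ℝ :=
  (1 / Real.Gamma (1 - β)) * ∫ τ in (0:ℝ)..t, (t - τ) ^ (-β) * deriv h τ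

/-- A function is of exponential order on `[0,∞)` if `|h(x)| ≤ C e^{a x}` there. -/
def ExpOrder (h : ℝ → ℝ) : Prop :=
  ∃ C a : ℝ, 0 < C ∧ 0 < a ∧ ∀ x : ℝ, 0 ≤ x → |h x| ≤ C * Real.exp (a * x)

theorem integrableOn_rpow_sub_one_mul_exp_neg {s r : ℝ} (hs : 0 < s) (hr : 0 < r) :
    IntegrableOn (fun u : ℝ => u ^ (s - 1) * Real.exp (-(r * u))) (Ioi 0) := by
  have h := integrableOn_rpow_mul_exp_neg_mul_rpow (s := s - 1) (p := 1) (b := r)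
    (by linarith) one_pos hr
  simpa using h

theorem norm_cexp_neg_ofReal_mul (u : ℝ) (z : ℂ) :
    ‖Complex.exp (-(u * z))‖ = Real.exp (-(z.re * u)) := by
  rw [Complex.norm_exp]
  simp [mul_comm]

theorem integrableOn_rpow_sub_one_mul_cexp_neg {s : ℝ} {z : ℂ} (hs : 0 < s) (hz : 0 < z.re) :
    IntegrableOn (fun u : ℝ => ((u ^ (s - 1) : ℝ) : ℂ) * Complex.exp (-(u * z))) (Ioi 0) := by
  refine (integrableOn_rpow_sub_one_mul_exp_neg hs hz).mono' ?_ ?_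
  · exact Measurable.aestronglyMeasurable (by fun_prop)
  · filter_upwards [ae_restrict_mem measurableSet_Ioi] with u hu
    rw [norm_mul, norm_cexp_neg_ofReal_mul, Complex.norm_real,
      Real.norm_of_nonneg (rpow_nonneg (le_of_lt hu) _)]

/-- The Laplace transform of a power, at a complex argument. -/
theorem integral_rpow_sub_one_mul_cexp_neg {s : ℝ} {z : ℂ} (hs : 0 < s) (hz : 0 < z.re) :
    ∫ u in Ioi (0 : ℝ), ((u ^ (s - 1) : ℝ) : ℂ) * Complex.exp (-(u * z)) =
      z ^ (-(s : ℂ)) * Complex.Gamma s := by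
  set U : Set ℂ := {w | 0 < w.re} with hU
  have hUo : IsOpen U := isOpen_lt continuous_const Complex.continuous_re
  have hUc : IsPreconnected U := (convex_halfSpace_re_gt 0).isPreconnected
  have hF : DifferentiableOn ℂ (fun w : ℂ => ∫ u in Ioi (0 : ℝ),
      ((u ^ (s - 1) : ℝ) : ℂ) * Complex.exp (-(u * w))) U := by
    intro w hw
    have hw' : 0 < w.re := hw
    have hnhds : {v : ℂ | w.re / 2 < v.re} ∈ nhds w :=
      (isOpen_lt continuous_const Complex.continuous_re).mem_nhds (by simp; linarith)
    have := (hasDerivAt_integral_of_dominated_loc_of_deriv_le (μ := volume.restrict (Ioi (0 : ℝ)))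
      (F := fun (w : ℂ) (u : ℝ) => ((u ^ (s - 1) : ℝ) : ℂ) * Complex.exp (-(u * w)))
      (F' := fun (w : ℂ) (u : ℝ) =>
        ((u ^ (s - 1) : ℝ) : ℂ) * (Complex.exp (-(u * w)) * (-u)))
      (bound := fun u : ℝ => u ^ ((s + 1) - 1) * Real.exp (-(w.re / 2 * u)))
      hnhds ?_ (integrableOn_rpow_sub_one_mul_cexp_neg hs hw') ?_ ?_
      (integrableOn_rpow_sub_one_mul_exp_neg (by linarith) (by linarith)) ?_).2
    · exact this.differentiableAt.differentiableWithinAt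
    · exact Eventually.of_forall fun v => Measurable.aestronglyMeasurable (by fun_prop)
    · exact Measurable.aestronglyMeasurable (by fun_prop)
    · filter_upwards [ae_restrict_mem measurableSet_Ioi] with u hu v hv
      have hu : 0 < u := hu
      have hv : w.re / 2 < v.re := hv
      rw [norm_mul, norm_mul, norm_cexp_neg_ofReal_mul, Complex.norm_real, norm_neg,
        Complex.norm_real, Real.norm_of_nonneg (rpow_nonneg hu.le _), Real.norm_of_nonneg hu.le]
      have : u ^ ((s + 1) - 1) = u ^ (s - 1) * u := by
        rw [← rpow_add_one hu.ne']; ring_nf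
      rw [this, mul_comm (Real.exp _) u, ← mul_assoc]
      gcongr
    · filter_upwards with u v _
      have h1 : HasDerivAt (fun v : ℂ => -((u : ℂ) * v)) (-u) v := by
        simpa using ((hasDerivAt_id v).const_mul (u : ℂ)).fun_neg
      exact (h1.cexp).const_mul _
  have hG : DifferentiableOn ℂ (fun w : ℂ => w ^ (-(s : ℂ)) * Complex.Gamma s) U := by
    intro w hw
    refine ((DifferentiableAt.cpow_const differentiableAt_id
      (Or.inl hw)).mul_const _).differentiableWithinAt
  refine (hF.analyticOnNhd hUo).eqOn_of_preconnected_of_frequently_eq (hG.analyticOnNhd hUo)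
    hUc (z₀ := 1) (by simp [hU]) ?_ hz
  have hreal : ∀ r : ℝ, 0 < r → ∫ u in Ioi (0 : ℝ),
      ((u ^ (s - 1) : ℝ) : ℂ) * Complex.exp (-(u * r)) = (r : ℂ) ^ (-(s : ℂ)) * Complex.Gamma s := by
    intro r hr
    have h := Real.integral_rpow_mul_exp_neg_mul_Ioi hs hr
    have h2 : ∀ u : ℝ, ((u ^ (s - 1) : ℝ) : ℂ) * Complex.exp (-(u * r)) =
        ((u ^ (s - 1) * Real.exp (-(r * u)) : ℝ) : ℂ) := by
      intro u; push_cast; rw [mul_comm (u : ℂ)]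
    simp_rw [h2]
    rw [integral_complex_ofReal, h, Complex.Gamma_ofReal, one_div, inv_rpow hr.le, ← rpow_neg hr.le]
    push_cast [Complex.ofReal_cpow hr.le]
    rfl
  have ht : Tendsto (fun r : ℝ => (r : ℂ)) (nhdsWithin 1 {1}ᶜ) (nhdsWithin 1 {1}ᶜ) := by
    refine tendsto_nhdsWithin_iff.2 ⟨?_, ?_⟩
    · exact (Complex.continuous_ofReal.tendsto' 1 1 (by simp)).mono_left nhdsWithin_le_nhds
    · filter_upwards [self_mem_nhdsWithin] with r hr
      simpa using hr
  refine ht.frequently (Eventually.frequently ?_)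
  filter_upwards [mem_nhdsWithin_of_mem_nhds (Ioi_mem_nhds (zero_lt_one' ℝ))] with r hr
  exact hreal r hr

/-- The angle `π β / (1 + β)`, for which the ray of argument `-wrightAngle β` is mapped by
`z ↦ (e^{iπ} z)^β` to the ray of argument `wrightAngle β`, both in the right half-plane. -/
noncomputable def wrightAngle (β : ℝ) : ℝ := π * β / (1 + β)

/-- The unit complex number of argument `wrightAngle β`. -/
noncomputable def wrightDir (β : ℝ) : ℂ := Complex.exp (wrightAngle β * Complex.I)

theorem wrightAngle_mem {β : ℝ} (hβ0 : 0 < β) (hβ1 : β < 1) :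
    0 < wrightAngle β ∧ wrightAngle β < π / 2 := by
  unfold wrightAngle
  have := pi_pos
  constructor
  · positivity
  · rw [div_lt_div_iff₀ (by linarith) two_pos]
    nlinarith

theorem wrightDir_re (β : ℝ) : (wrightDir β).re = Real.cos (wrightAngle β) := by
  rw [wrightDir, Complex.exp_ofReal_mul_I_re]

theorem wrightDir_re_pos {β : ℝ} (hβ0 : 0 < β) (hβ1 : β < 1) : 0 < (wrightDir β).re := by
  rw [wrightDir_re]
  have := wrightAngle_mem hβ0 hβ1
  exact cos_pos_of_mem_Ioo ⟨by linarith [pi_pos], this.2⟩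

theorem norm_wrightDir (β : ℝ) : ‖wrightDir β‖ = 1 := Complex.norm_exp_ofReal_mul_I _

theorem wrightDir_cpow {β : ℝ} (hβ0 : 0 < β) (hβ1 : β < 1) (y : ℝ) :
    wrightDir β ^ (y : ℂ) = Complex.exp ((wrightAngle β * y : ℝ) * Complex.I) := by
  have h := wrightAngle_mem hβ0 hβ1
  have := pi_pos
  rw [wrightDir, Complex.cpow_def_of_ne_zero (Complex.exp_ne_zero _), Complex.log_exp]
  · push_cast; ring_nf
  · simp; linarith
  · simp; linarith

theorem conj_wrightDir (β : ℝ) :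
    (starRingEnd ℂ) (wrightDir β) = Complex.exp ((-wrightAngle β : ℝ) * Complex.I) := by
  rw [wrightDir, ← Complex.exp_conj]
  simp

theorem conj_wrightDir_cpow {β : ℝ} (hβ0 : 0 < β) (hβ1 : β < 1) (y : ℝ) :
    (starRingEnd ℂ) (wrightDir β) ^ (y : ℂ) =
      Complex.exp ((-wrightAngle β * y : ℝ) * Complex.I) := by
  have h := wrightAngle_mem hβ0 hβ1
  have := pi_pos
  rw [conj_wrightDir, Complex.cpow_def_of_ne_zero (Complex.exp_ne_zero _), Complex.log_exp]
  · push_cast; ring_nf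
  · simp; linarith
  · simp; linarith

/-- A Hankel-type representation of the reciprocal Gamma function. -/
theorem one_div_Gamma_one_sub_mul {β η : ℝ} (hβ0 : 0 < β) (hβ1 : β < 1) (hη : 0 < η) :
    1 / Real.Gamma (1 - β * η) = 1 / π * (wrightDir β ^ (η : ℂ) *
      ∫ u in Ioi (0 : ℝ), ((u ^ (β * η - 1) : ℝ) : ℂ) *
        Complex.exp (-(u * (starRingEnd ℂ) (wrightDir β)))).im := by
  have hs : 0 < β * η := mul_pos hβ0 hη
  rw [integral_rpow_sub_one_mul_cexp_neg hs (by simpa using wrightDir_re_pos hβ0 hβ1),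
    wrightDir_cpow hβ0 hβ1, ← Complex.ofReal_neg, conj_wrightDir_cpow hβ0 hβ1, Complex.Gamma_ofReal,
    ← mul_assoc, ← Complex.exp_add, ← add_mul, ← Complex.ofReal_add, Complex.im_mul_ofReal,
    Complex.exp_ofReal_mul_I_im]
  have harg : wrightAngle β * η + -wrightAngle β * -(β * η) = π * (β * η) := by
    unfold wrightAngle
    have : 1 + β ≠ 0 := by linarith
    field_simp
  have hG := Real.Gamma_mul_Gamma_one_sub (β * η)
  have hG0 := (Real.Gamma_pos_of_pos hs).ne'
  have hpi := pi_pos.ne'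
  have h1 : Real.Gamma (1 - β * η) = π / Real.sin (π * (β * η)) / Real.Gamma (β * η) := by
    rw [← hG]; field_simp
  rw [harg, h1, one_div, inv_div, div_div_eq_mul_div]
  ring

theorem exists_mul_rpow_le_add {β x ε : ℝ} (hβ0 : 0 < β) (hβ1 : β < 1) (hx : 0 ≤ x) (hε : 0 < ε) :
    ∃ C, ∀ u : ℝ, 0 ≤ u → x * u ^ β ≤ ε * u + C := by
  have ho := (tendsto_rpow_neg_atTop (y := 1 - β) (by linarith)).eventually_le_const
    (show 0 < ε / (x + 1) by positivity)
  obtain ⟨R, hR⟩ := eventually_atTop.1 (ho.and (eventually_gt_atTop 0))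
  refine ⟨x * (max R 0) ^ β, fun u hu => ?_⟩
  rcases le_total R u with h | h
  · obtain ⟨h0, h1⟩ := hR u h
    have : u ^ β ≤ ε / (x + 1) * u := by
      have h4 : u ^ β = u ^ (-(1 - β)) * u := by rw [← rpow_add_one h1.ne']; ring_nf
      rw [h4]; gcongr
    have h2 : x * u ^ β ≤ x * (ε / (x + 1) * u) := by gcongr
    have h3 : x * (ε / (x + 1) * u) ≤ ε * u := by
      have : x / (x + 1) ≤ 1 := by rw [div_le_one (by linarith)]; linarith
      calc x * (ε / (x + 1) * u) = x / (x + 1) * (ε * u) := by ring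
        _ ≤ 1 * (ε * u) := by gcongr
        _ = _ := one_mul _
    have : 0 ≤ x * (max R 0) ^ β := by positivity
    linarith
  · have : u ^ β ≤ (max R 0) ^ β := by gcongr; exact h.trans (le_max_left _ _)
    have : x * u ^ β ≤ x * (max R 0) ^ β := by gcongr
    have : 0 ≤ ε * u := by positivity
    linarith

/-- The integrand of the Hankel-type representation of the Wright function. -/
noncomputable def wrightKernel (β x u : ℝ) : ℂ :=
  ((u ^ (β - 1) : ℝ) : ℂ) * Complex.exp (-(u * (starRingEnd ℂ) (wrightDir β))) *
    (wrightDir β * Complex.exp (-((x * u ^ β : ℝ) * wrightDir β)))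

theorem measurable_wrightKernel (β : ℝ) :
    Measurable (fun q : ℝ × ℝ => wrightKernel β q.1 q.2) := by
  unfold wrightKernel
  fun_prop

theorem norm_wrightKernel {β x u : ℝ} (hu : 0 ≤ u) :
    ‖wrightKernel β x u‖ = u ^ (β - 1) * Real.exp (-((wrightDir β).re * u)) *
      Real.exp (-((wrightDir β).re * (x * u ^ β))) := by
  rw [wrightKernel, norm_mul, norm_mul, norm_mul, norm_wrightDir, norm_cexp_neg_ofReal_mul,
    norm_cexp_neg_ofReal_mul, Complex.norm_real, Real.norm_of_nonneg (rpow_nonneg hu _),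
    Complex.conj_re, one_mul]

theorem norm_wrightKernel_le {β x u : ℝ} (hβ0 : 0 < β) (hβ1 : β < 1) (hx : 0 ≤ x) (hu : 0 ≤ u) :
    ‖wrightKernel β x u‖ ≤ u ^ (β - 1) * Real.exp (-((wrightDir β).re * u)) := by
  rw [norm_wrightKernel hu]
  refine mul_le_of_le_one_right (by positivity) (exp_le_one_iff.2 ?_)
  have := wrightDir_re_pos hβ0 hβ1
  have : 0 ≤ (wrightDir β).re * (x * u ^ β) := by positivity
  linarith

theorem integrableOn_wrightKernel {β x : ℝ} (hβ0 : 0 < β) (hβ1 : β < 1) (hx : 0 ≤ x) :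
    IntegrableOn (wrightKernel β x) (Ioi 0) := by
  refine (integrableOn_rpow_sub_one_mul_exp_neg hβ0 (wrightDir_re_pos hβ0 hβ1)).mono' ?_ ?_
  · exact ((measurable_wrightKernel β).comp measurable_prodMk_left).aestronglyMeasurable
  · filter_upwards [ae_restrict_mem measurableSet_Ioi] with u hu
    exact norm_wrightKernel_le hβ0 hβ1 hx (le_of_lt hu)

/-- The power series of the Wright function sums to the Hankel-type integral. -/
theorem hasSum_wright {β x : ℝ} (hβ0 : 0 < β) (hβ1 : β < 1) (hx : 0 ≤ x) :
    HasSum (fun k : ℕ => (-x) ^ k / ((Nat.factorial k : ℝ) * Real.Gamma (1 - β * (k + 1))))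
      (1 / π * (∫ u in Ioi (0 : ℝ), wrightKernel β x u).im) := by
  set a := (starRingEnd ℂ) (wrightDir β) with ha
  set b := wrightDir β with hb
  have hre : 0 < b.re := wrightDir_re_pos hβ0 hβ1
  have hare : a.re = b.re := Complex.conj_re _
  have key : HasSum (fun k : ℕ => ∫ u in Ioi (0 : ℝ),
      ((u ^ (β - 1) : ℝ) : ℂ) * Complex.exp (-(u * a)) *
        (b * ((-((x * u ^ β : ℝ) * b)) ^ k / (Nat.factorial k : ℂ))))
      (∫ u in Ioi (0 : ℝ), wrightKernel β x u) := by
    refine hasSum_integral_of_dominated_convergence (fun k u =>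
      u ^ (β - 1) * Real.exp (-(b.re * u)) * ((x * u ^ β) ^ k / (Nat.factorial k : ℝ)))
      ?_ ?_ ?_ ?_ ?_
    · exact fun k => Measurable.aestronglyMeasurable (by fun_prop)
    · intro k
      filter_upwards [ae_restrict_mem measurableSet_Ioi] with u hu
      have hu : 0 < u := hu
      apply le_of_eq
      have hn : ‖b‖ = 1 := norm_wrightDir β
      rw [norm_mul, norm_mul, norm_mul, norm_div, norm_pow, norm_neg, norm_mul, hn,
        norm_cexp_neg_ofReal_mul, hare, Complex.norm_real, Complex.norm_real,
        Real.norm_of_nonneg (rpow_nonneg hu.le _), Real.norm_of_nonneg (by positivity)]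
      simp
    · filter_upwards with u
      exact (Real.summable_pow_div_factorial _).mul_left _
    · have hs : ∀ u : ℝ, ∑' k : ℕ, u ^ (β - 1) * Real.exp (-(b.re * u)) *
          ((x * u ^ β) ^ k / (Nat.factorial k : ℝ)) =
          u ^ (β - 1) * Real.exp (-(b.re * u)) * Real.exp (x * u ^ β) := by
        intro u
        rw [tsum_mul_left, Real.exp_eq_exp_ℝ, NormedSpace.exp_eq_tsum_div]
      simp_rw [hs]
      obtain ⟨C, hC⟩ := exists_mul_rpow_le_add (ε := b.re / 2) hβ0 hβ1 hx (by linarith)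
      refine ((integrableOn_rpow_sub_one_mul_exp_neg hβ0 (half_pos hre)).mul_const
        (Real.exp C)).mono' (Measurable.aestronglyMeasurable (by fun_prop)) ?_
      filter_upwards [ae_restrict_mem measurableSet_Ioi] with u hu
      have hu : 0 < u := hu
      rw [Real.norm_of_nonneg (by positivity), mul_assoc, mul_assoc, ← Real.exp_add, ← Real.exp_add]
      refine mul_le_mul_of_nonneg_left (exp_le_exp.2 ?_) (by positivity)
      linarith [hC u hu.le]
    · filter_upwards with u
      have := (NormedSpace.expSeries_div_hasSum_exp (-((x * u ^ β : ℝ) * b)))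
      rw [← Complex.exp_eq_exp_ℂ] at this
      exact (this.mul_left b).mul_left _
  have key2 := (Complex.hasSum_im key).mul_left (1 / π)
  convert! key2 using 1
  ext k
  have hk : (0 : ℝ) < k + 1 := by positivity
  have hA := one_div_Gamma_one_sub_mul hβ0 hβ1 hk
  have hI : ∫ u in Ioi (0 : ℝ),
      ((u ^ (β - 1) : ℝ) : ℂ) * Complex.exp (-(u * a)) *
        (b * ((-((x * u ^ β : ℝ) * b)) ^ k / (Nat.factorial k : ℂ))) =
      (((-x) ^ k / (Nat.factorial k : ℝ) : ℝ) : ℂ) * (b ^ (((k : ℝ) + 1 : ℝ) : ℂ) *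
      ∫ u in Ioi (0 : ℝ), ((u ^ (β * (k + 1) - 1) : ℝ) : ℂ) * Complex.exp (-(u * a))) := by
    rw [← integral_const_mul, ← integral_const_mul]
    refine setIntegral_congr_fun measurableSet_Ioi fun u hu => ?_
    have hu : 0 < u := hu
    have h1 : u ^ (β * (k + 1) - 1) = u ^ (β - 1) * (u ^ β) ^ k := by
      rw [← rpow_mul_natCast hu.le, ← rpow_add hu]; ring_nf
    have h2 : b ^ (((k : ℝ) + 1 : ℝ) : ℂ) = b ^ (k + 1) := by
      rw [← Complex.cpow_natCast]; push_cast; rfl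
    simp only [h1, h2]
    push_cast
    rw [neg_pow ((x : ℂ) * _ * _), neg_pow (x : ℂ), mul_pow, mul_pow]
    ring
  rw [hI, Complex.im_ofReal_mul, div_mul_eq_div_div, div_eq_mul_one_div _ (Real.Gamma _), hA]
  ring

/-- The function `∑_k (-x)^k / (k! Γ(1 - β(k+1)))`, as a Hankel-type integral. -/
noncomputable def wrightIntegral (β x : ℝ) : ℝ :=
  1 / π * (∫ u in Ioi (0 : ℝ), wrightKernel β x u).im

theorem measurable_wrightIntegral (β : ℝ) : Measurable (wrightIntegral β) := by
  have h : StronglyMeasurable fun x : ℝ => ∫ u in Ioi (0 : ℝ), wrightKernel β x u :=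
    StronglyMeasurable.integral_prod_right (f := wrightKernel β)
      (measurable_wrightKernel β).stronglyMeasurable
  exact (Complex.measurable_im.comp h.measurable).const_mul _

theorem abs_wrightIntegral_le {β x : ℝ} (hβ0 : 0 < β) (hβ1 : β < 1) (hx : 0 ≤ x) :
    |wrightIntegral β x| ≤
      1 / π * ∫ u in Ioi (0 : ℝ), u ^ (β - 1) * Real.exp (-((wrightDir β).re * u)) := by
  have hpi := pi_pos
  rw [wrightIntegral, abs_mul, abs_of_pos (by positivity)]
  gcongr
  refine (Complex.abs_im_le_norm _).trans (norm_integral_le_of_norm_le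
    (integrableOn_rpow_sub_one_mul_exp_neg hβ0 (wrightDir_re_pos hβ0 hβ1)) ?_)
  filter_upwards [ae_restrict_mem measurableSet_Ioi] with u hu
  exact norm_wrightKernel_le hβ0 hβ1 hx (le_of_lt hu)

theorem integral_rpow_mul_cexp_neg_rpow {β x : ℝ} {b : ℂ} (hβ0 : 0 < β) (hx : 0 < x)
    (hb : 0 < b.re) :
    ∫ u in Ioi (0 : ℝ), ((u ^ (β - 1) : ℝ) : ℂ) * (b * Complex.exp (-((x * u ^ β : ℝ) * b))) =
      ((1 / (β * x) : ℝ) : ℂ) := by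
  have h := integral_comp_rpow_Ioi (fun y : ℝ => b * Complex.exp (-(y * (x * b)))) hβ0.ne'
  have h1 := integral_rpow_sub_one_mul_cexp_neg (s := 1) (z := x * b) one_pos
    (by rw [Complex.re_ofReal_mul]; positivity)
  have hb0 : b ≠ 0 := by rintro rfl; simp at hb
  simp only [sub_self, rpow_zero, Complex.ofReal_one, one_mul, Complex.Gamma_one, mul_one,
    Complex.cpow_neg_one] at h1
  rw [integral_const_mul, h1, abs_of_pos hβ0] at h
  have h2 : ∀ u : ℝ, (β * u ^ (β - 1)) • (b * Complex.exp (-((u ^ β : ℝ) * (x * b)))) =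
      (β : ℂ) * (((u ^ (β - 1) : ℝ) : ℂ) * (b * Complex.exp (-((x * u ^ β : ℝ) * b)))) := by
    intro u
    rw [Complex.real_smul]
    push_cast
    rw [show (x : ℂ) * ((u ^ β : ℝ) : ℂ) * b = ((u ^ β : ℝ) : ℂ) * (x * b) by ring]
    ring
  simp_rw [h2] at h
  rw [integral_const_mul] at h
  have hβ' : (β : ℂ) ≠ 0 := by exact_mod_cast hβ0.ne'
  have hx' : (x : ℂ) ≠ 0 := by exact_mod_cast hx.ne'
  apply mul_left_cancel₀ hβ'
  rw [h]
  push_cast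
  field_simp

theorem norm_cexp_neg_sub_one_le {a : ℂ} {u : ℝ} (ha : 0 < a.re) (hna : ‖a‖ = 1) (hu : 0 ≤ u) :
    ‖Complex.exp (-(u * a)) - 1‖ ≤ 2 * u := by
  have hn : ‖-((u : ℂ) * a)‖ = u := by
    rw [norm_neg, norm_mul, hna, mul_one, Complex.norm_real, Real.norm_of_nonneg hu]
  rcases le_total u 1 with h | h
  · simpa only [hn] using Complex.norm_exp_sub_one_le (x := -((u : ℂ) * a)) (hn.trans_le h)
  · refine (norm_sub_le _ _).trans ?_
    rw [norm_cexp_neg_ofReal_mul, norm_one]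
    have : Real.exp (-(a.re * u)) ≤ 1 := exp_le_one_iff.2 (by have : 0 ≤ a.re * u := by positivity
                                                              linarith)
    linarith

theorem abs_wrightIntegral_le_rpow {β x : ℝ} (hβ0 : 0 < β) (hβ1 : β < 1) (hx : 0 < x) :
    |wrightIntegral β x| ≤ 1 / π * (2 * (((wrightDir β).re * x) ^ (-(β + 1) / β) * (1 / β) *
      Real.Gamma ((β + 1) / β))) := by
  have hpi := pi_pos
  have hc := wrightDir_re_pos hβ0 hβ1
  set b := wrightDir β with hb
  set K₀ : ℝ → ℂ := fun u =>
    ((u ^ (β - 1) : ℝ) : ℂ) * (b * Complex.exp (-((x * u ^ β : ℝ) * b))) with hK₀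
  have hn₀ : ∀ u : ℝ, 0 < u → ‖K₀ u‖ = u ^ (β - 1) * Real.exp (-(b.re * x) * u ^ β) := by
    intro u hu
    rw [hK₀, norm_mul, norm_mul, hb, norm_wrightDir, norm_cexp_neg_ofReal_mul, Complex.norm_real,
      Real.norm_of_nonneg (rpow_nonneg hu.le _), one_mul]
    ring_nf
  have hint : IntegrableOn K₀ (Ioi 0) := by
    refine (integrableOn_rpow_mul_exp_neg_mul_rpow (s := β - 1) (p := β) (b := b.re * x)
      (by linarith) hβ0 (by positivity)).mono' (Measurable.aestronglyMeasurable (by fun_prop)) ?_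
    filter_upwards [ae_restrict_mem measurableSet_Ioi] with u hu
    exact (hn₀ u hu).le
  have him : (∫ u in Ioi (0 : ℝ), wrightKernel β x u).im =
      (∫ u in Ioi (0 : ℝ), (wrightKernel β x u - K₀ u)).im := by
    rw [integral_sub (integrableOn_wrightKernel hβ0 hβ1 hx.le) hint,
      integral_rpow_mul_cexp_neg_rpow hβ0 hx hc, Complex.sub_im, Complex.ofReal_im, sub_zero]
  rw [wrightIntegral, abs_mul, abs_of_pos (by positivity), him,
    ← integral_rpow_mul_exp_neg_mul_rpow hβ0 (by linarith) (by positivity), ← integral_const_mul]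
  gcongr
  refine (Complex.abs_im_le_norm _).trans (norm_integral_le_of_norm_le
    ((integrableOn_rpow_mul_exp_neg_mul_rpow (by linarith) hβ0 (by positivity)).const_mul 2) ?_)
  filter_upwards [ae_restrict_mem measurableSet_Ioi] with u hu
  have hu : 0 < u := hu
  have hfac : wrightKernel β x u - K₀ u =
      (Complex.exp (-(u * (starRingEnd ℂ) b)) - 1) * K₀ u := by
    simp only [wrightKernel, hK₀]; ring
  have hbd := norm_cexp_neg_sub_one_le (a := (starRingEnd ℂ) b) (u := u) (by simpa using hc)
    (by rw [RCLike.norm_conj]; exact norm_wrightDir β) hu.le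
  rw [hfac, norm_mul, hn₀ u hu]
  calc _ ≤ 2 * u * (u ^ (β - 1) * Real.exp (-(b.re * x) * u ^ β)) := by gcongr
    _ = 2 * (u ^ (β - 1) * u * Real.exp (-(b.re * x) * u ^ β)) := by ring
    _ = _ := by rw [← rpow_add_one hu.ne', sub_add_cancel]

theorem integrableOn_wrightIntegral {β : ℝ} (hβ0 : 0 < β) (hβ1 : β < 1) :
    IntegrableOn (wrightIntegral β) (Ioi 0) := by
  have hc := wrightDir_re_pos hβ0 hβ1
  have hm := (measurable_wrightIntegral β).aestronglyMeasurable (μ := volume)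
  rw [← Ioc_union_Ioi_eq_Ioi zero_le_one, integrableOn_union]
  constructor
  · refine Measure.integrableOn_of_bounded (M := 1 / π *
      ∫ u in Ioi (0 : ℝ), u ^ (β - 1) * Real.exp (-((wrightDir β).re * u))) (by simp) hm ?_
    filter_upwards [ae_restrict_mem measurableSet_Ioc] with x hx
    exact abs_wrightIntegral_le hβ0 hβ1 hx.1.le
  · have hexp : -(β + 1) / β < -1 := by
      rw [div_lt_iff₀ hβ0]; linarith
    refine Integrable.mono' ((integrableOn_Ioi_rpow_of_lt hexp one_pos).const_mul
      (1 / π * (2 * ((wrightDir β).re ^ (-(β + 1) / β) * (1 / β) *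
      Real.Gamma ((β + 1) / β))))) hm.restrict ?_
    filter_upwards [ae_restrict_mem measurableSet_Ioi] with x hx
    have hx : 0 < x := one_pos.trans hx
    refine (abs_wrightIntegral_le_rpow hβ0 hβ1 hx).trans_eq ?_
    rw [mul_rpow hc.le hx.le]
    ring

theorem ofReal_mul_cpow {r : ℝ} {z : ℂ} (hr : 0 < r) (hz : z ≠ 0) (w : ℂ) :
    ((r : ℂ) * z) ^ w = (r : ℂ) ^ w * z ^ w := by
  have hr0 : (r : ℂ) ≠ 0 := by exact_mod_cast hr.ne'
  rw [Complex.cpow_def_of_ne_zero (mul_ne_zero hr0 hz), Complex.cpow_def_of_ne_zero hr0,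
    Complex.cpow_def_of_ne_zero hz, Complex.log_ofReal_mul hr hz, ← Complex.exp_add,
    Complex.ofReal_log hr.le, add_mul]

/-- The Mellin transform of the Wright function. -/
theorem integral_rpow_mul_wrightIntegral {β η : ℝ} (hβ0 : 0 < β) (hβ1 : β < 1) (hη0 : 0 < η)
    (hη1 : η < 1) :
    ∫ x in Ioi (0 : ℝ), x ^ (-η) * wrightIntegral β x =
      Real.Gamma (1 - η) / Real.Gamma (1 - β * η) := by
  have hc := wrightDir_re_pos hβ0 hβ1
  have hη : (1 - η) - 1 = -η := by ring
  set b := wrightDir β with hb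
  have hmeas : Measurable (fun q : ℝ × ℝ => ((q.1 ^ (-η) : ℝ) : ℂ) * wrightKernel β q.1 q.2) :=
    (Complex.measurable_ofReal.comp (by fun_prop)).mul (measurable_wrightKernel β)
  have hnorm : ∀ x u : ℝ, 0 < x → 0 < u → ‖((x ^ (-η) : ℝ) : ℂ) * wrightKernel β x u‖ =
      u ^ (β - 1) * Real.exp (-(b.re * u)) *
        (x ^ ((1 - η) - 1) * Real.exp (-((b.re * u ^ β) * x))) := by
    intro x u hx hu
    rw [norm_mul, norm_wrightKernel hu.le, Complex.norm_real,
      Real.norm_of_nonneg (rpow_nonneg hx.le _), hη, ← hb, mul_assoc b.re (u ^ β) x,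
      mul_comm (u ^ β) x]
    ring
  have hprod : Integrable (Function.uncurry fun x u : ℝ =>
      ((x ^ (-η) : ℝ) : ℂ) * wrightKernel β x u)
      ((volume.restrict (Ioi (0 : ℝ))).prod (volume.restrict (Ioi (0 : ℝ)))) := by
    refine (integrable_prod_iff' hmeas.aestronglyMeasurable).2 ⟨?_, ?_⟩
    · filter_upwards [ae_restrict_mem measurableSet_Ioi] with u hu
      have hu : 0 < u := hu
      refine ((integrableOn_rpow_sub_one_mul_exp_neg (s := 1 - η) (r := b.re * u ^ β)
        (by linarith) (by positivity)).const_mul (u ^ (β - 1) * Real.exp (-(b.re * u)))).mono'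
        (hmeas.comp measurable_prodMk_right).aestronglyMeasurable ?_
      filter_upwards [ae_restrict_mem measurableSet_Ioi] with x hx
      exact (hnorm x u hx hu).le
    · have h := (integrableOn_rpow_sub_one_mul_exp_neg (s := β * η) (by positivity) hc).const_mul
        ((1 / b.re) ^ (1 - η) * Real.Gamma (1 - η))
      refine h.congr ?_
      filter_upwards [ae_restrict_mem measurableSet_Ioi] with u hu
      have hu : 0 < u := hu
      have h1 : ∫ x in Ioi (0 : ℝ), ‖((x ^ (-η) : ℝ) : ℂ) * wrightKernel β x u‖ =
          ∫ x in Ioi (0 : ℝ), u ^ (β - 1) * Real.exp (-(b.re * u)) *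
            (x ^ ((1 - η) - 1) * Real.exp (-((b.re * u ^ β) * x))) :=
        setIntegral_congr_fun measurableSet_Ioi fun x hx => hnorm x u hx hu
      rw [h1, integral_const_mul,
        Real.integral_rpow_mul_exp_neg_mul_Ioi (by linarith) (by positivity), one_div, one_div,
        mul_inv, mul_rpow (by positivity) (by positivity), inv_rpow (rpow_nonneg hu.le _),
        ← rpow_mul hu.le, ← rpow_neg hu.le]
      have h2 : u ^ (β * η - 1) = u ^ (β - 1) * u ^ (-(β * (1 - η))) := by
        rw [← rpow_add hu]; ring_nf
      rw [h2]
      ring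
  have hleft : ∫ x in Ioi (0 : ℝ), x ^ (-η) * wrightIntegral β x = 1 / π *
      (∫ x in Ioi (0 : ℝ), ∫ u in Ioi (0 : ℝ), ((x ^ (-η) : ℝ) : ℂ) * wrightKernel β x u).im := by
    have := integral_im (𝕜 := ℂ) hprod.integral_prod_left
    simp only [Function.uncurry_apply_pair, RCLike.im_to_complex] at this
    rw [← this, ← integral_const_mul]
    refine integral_congr_ae (Eventually.of_forall fun x => ?_)
    simp only
    rw [integral_const_mul, Complex.im_ofReal_mul, wrightIntegral]
    ring
  have hinner : ∀ u ∈ Ioi (0 : ℝ),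
      ∫ x in Ioi (0 : ℝ), ((x ^ (-η) : ℝ) : ℂ) * wrightKernel β x u =
      (Real.Gamma (1 - η) : ℂ) * (b ^ (η : ℂ) * (((u ^ (β * η - 1) : ℝ) : ℂ) *
        Complex.exp (-(u * (starRingEnd ℂ) b)))) := by
    intro u hu
    have hu : 0 < u := hu
    have hb0 : b ≠ 0 := Complex.exp_ne_zero _
    have hub : 0 < u ^ β := rpow_pos_of_pos hu _
    have h1 := integral_rpow_sub_one_mul_cexp_neg (s := 1 - η) (z := (u ^ β : ℝ) * b)
      (by linarith) (by rw [Complex.re_ofReal_mul]; positivity)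
    have h2 : ∀ x : ℝ, ((x ^ (-η) : ℝ) : ℂ) * wrightKernel β x u =
        ((u ^ (β - 1) : ℝ) : ℂ) * Complex.exp (-(u * (starRingEnd ℂ) b)) * b *
        (((x ^ ((1 - η) - 1) : ℝ) : ℂ) * Complex.exp (-(x * ((u ^ β : ℝ) * b)))) := by
      intro x
      rw [wrightKernel, hη, ← hb, ← mul_assoc (x : ℂ), ← Complex.ofReal_mul]
      ring
    have h3 : u ^ (β * η - 1) = u ^ (β - 1) * (u ^ β) ^ (-(1 - η)) := by
      rw [← rpow_mul hu.le, ← rpow_add hu]; ring_nf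
    have h4 : b ^ (η : ℂ) = b * b ^ (-((1 - η : ℝ) : ℂ)) := by
      nth_rewrite 2 [← Complex.cpow_one b]
      rw [← Complex.cpow_add _ _ hb0]; push_cast; ring_nf
    simp_rw [h2]
    rw [integral_const_mul, h1, ofReal_mul_cpow hub hb0, h3, h4,
      Complex.ofReal_mul, Complex.ofReal_cpow hub.le (-(1 - η)), Complex.Gamma_ofReal]
    push_cast
    ring
  rw [hleft, integral_integral_swap hprod, setIntegral_congr_fun measurableSet_Ioi hinner,
    integral_const_mul, integral_const_mul, Complex.im_ofReal_mul,
    div_eq_mul_one_div (Real.Gamma _), one_div_Gamma_one_sub_mul hβ0 hβ1 hη0]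
  ring

theorem integral_wrightIntegral {β : ℝ} (hβ0 : 0 < β) (hβ1 : β < 1) :
    ∫ x in Ioi (0 : ℝ), wrightIntegral β x = 1 := by
  have hI := integrableOn_wrightIntegral hβ0 hβ1
  have hm := measurable_wrightIntegral β
  have hη : ∀ᶠ η : ℝ in nhdsWithin 0 (Ioi 0), η ∈ Ioo (0 : ℝ) (1 / 2) :=
    Ioo_mem_nhdsGT (by norm_num)
  set C := 1 / π * ∫ u in Ioi (0 : ℝ), u ^ (β - 1) * Real.exp (-((wrightDir β).re * u)) with hC
  have hpow : IntegrableOn (fun x : ℝ => x ^ (-(1 / 2) : ℝ)) (Ioc 0 1) :=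
    (intervalIntegrable_iff_integrableOn_Ioc_of_le zero_le_one).1
      (intervalIntegral.intervalIntegrable_rpow' (by norm_num))
  have hbound : IntegrableOn (fun x : ℝ => (Ioc (0 : ℝ) 1).indicator
      (fun x => C * x ^ (-(1 / 2) : ℝ)) x + |wrightIntegral β x|) (Ioi 0) := by
    refine Integrable.add ?_ hI.abs
    exact ((integrable_indicator_iff measurableSet_Ioc).2 (hpow.const_mul C)).integrableOn
  have hlim : Tendsto (fun η : ℝ => ∫ x in Ioi (0 : ℝ), x ^ (-η) * wrightIntegral β x)
      (nhdsWithin 0 (Ioi 0)) (nhds (∫ x in Ioi (0 : ℝ), wrightIntegral β x)) := by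
    refine tendsto_integral_filter_of_dominated_convergence _
      (Eventually.of_forall fun η => Measurable.aestronglyMeasurable (by fun_prop)) ?_ hbound ?_
    · filter_upwards [hη] with η hη
      filter_upwards [ae_restrict_mem measurableSet_Ioi] with x hx
      have hx : 0 < x := hx
      rw [norm_mul, Real.norm_of_nonneg (rpow_nonneg hx.le _), Real.norm_eq_abs]
      rcases le_or_gt x 1 with h | h
      · rw [indicator_of_mem (show x ∈ Ioc (0 : ℝ) 1 from ⟨hx, h⟩)]
        have h1 : x ^ (-η) ≤ x ^ (-(1 / 2) : ℝ) :=
          rpow_le_rpow_of_exponent_ge hx h (by linarith [hη.2])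
        have h2 := abs_wrightIntegral_le hβ0 hβ1 hx.le
        have h3 := abs_nonneg (wrightIntegral β x)
        calc _ ≤ x ^ (-(1 / 2) : ℝ) * C := by gcongr
          _ ≤ _ := by linarith
      · rw [indicator_of_notMem (fun h' => absurd h'.2 (not_le.2 h)), zero_add]
        exact mul_le_of_le_one_left (abs_nonneg _)
          (rpow_le_one_of_one_le_of_nonpos h.le (by linarith [hη.1]))
    · filter_upwards [ae_restrict_mem measurableSet_Ioi] with x hx
      have hc : Continuous fun η : ℝ => x ^ (-η) * wrightIntegral β x :=
        (continuous_const.rpow continuous_neg fun _ => Or.inl (ne_of_gt hx)).mul_const _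
      exact (hc.tendsto' 0 _ (by simp)).mono_left nhdsWithin_le_nhds
  have hlim2 : Tendsto (fun η : ℝ => Real.Gamma (1 - η) / Real.Gamma (1 - β * η))
      (nhdsWithin 0 (Ioi 0)) (nhds 1) := by
    have hG : ContinuousAt Real.Gamma 1 :=
      (Real.differentiableAt_Gamma fun m => by
        have : (0 : ℝ) ≤ m := m.cast_nonneg
        linarith).continuousAt
    have h1 : ∀ c : ℝ, Tendsto (fun η : ℝ => Real.Gamma (1 - c * η)) (nhds 0) (nhds 1) := by
      intro c
      have h2 : Tendsto (fun η : ℝ => 1 - c * η) (nhds 0) (nhds 1) :=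
        Continuous.tendsto' (by fun_prop) _ _ (by simp)
      simpa [Function.comp_def] using hG.tendsto.comp h2
    have := (h1 1).div (h1 β) one_ne_zero
    simp only [one_mul, div_one] at this
    exact this.mono_left nhdsWithin_le_nhds
  refine tendsto_nhds_unique hlim (hlim2.congr' ?_)
  filter_upwards [hη] with η hη
  exact (integral_rpow_mul_wrightIntegral hβ0 hβ1 hη.1 (by linarith [hη.2])).symm

/-- For every `0 < β < 1` and `t > 0`, the Wright-type density
`g_β(·;t)` is a probability density on `[0,∞)`: `∫_0^∞ g_β(s;t) ds = 1`. -/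
theorem wrightG_is_probability_density (β t : ℝ) (hβ0 : 0 < β) (hβ1 : β < 1) (ht : 0 < t) :
    ∫ s in Set.Ioi (0:ℝ), wrightG β s t = 1 := by
  have htβ : 0 < t ^ β := rpow_pos_of_pos ht _
  have h : ∀ s ∈ Ioi (0 : ℝ), wrightG β s t = t ^ (-β) * wrightIntegral β ((t ^ β)⁻¹ * s) := by
    intro s hs
    have hs : 0 < s := hs
    have hsum := hasSum_wright (x := (t ^ β)⁻¹ * s) hβ0 hβ1 (by positivity)
    rw [wrightG, wrightIntegral, ← hsum.tsum_eq]
    simp only [show -s / t ^ β = -((t ^ β)⁻¹ * s) by ring]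
  rw [setIntegral_congr_fun measurableSet_Ioi h, integral_const_mul,
    integral_comp_mul_left_Ioi (wrightIntegral β) 0 (inv_pos.2 htβ), mul_zero,
    integral_wrightIntegral hβ0 hβ1, inv_inv, smul_eq_mul, mul_one, ← rpow_add ht]
  simp
end

section
/- For every 0 < β < 1, t > 0 and every real s > 0, the Laplace transform of g_β(·;t) in its first argument satisfies ∫_0^∞ e^{−s x} g_β(x;t) dx = E_β(−s t^β). -/
open MeasureTheory Real Set Filter

/-- The Laplace transform of the exponential generating function of the moments `∫ K E ^ (k + 1)`
is the power series in `-s` with coefficients the inverse moments `∫ K E ^ (-k)`. -/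
theorem laplace_tsum_eq_tsum_inv {X : Type*} [MeasurableSpace X] {μ : Measure X} [SFinite μ]
    {K E : X → ℂ} (hK : AEStronglyMeasurable K μ) (hE : AEStronglyMeasurable E μ)
    {s δ : ℝ} (hs : 0 < s) (hsδ : s < δ) (hδ : ∀ᵐ x ∂μ, δ ≤ (E x).re)
    (hint : ∀ b : ℝ, 0 ≤ b → Integrable (fun x => ‖K x‖ * Real.exp (b * ‖E x‖)) μ)
    {m n : ℕ → ℝ} (hm : ∀ k, (∫ x, K x * E x ^ (k + 1) ∂μ).im = m k)
    (hn : ∀ k, (∫ x, K x * (E x)⁻¹ ^ k ∂μ).im = n k) :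
    ∫ y in Ioi (0 : ℝ), Real.exp (-s * y) * ∑' k : ℕ, (-y) ^ k / (k.factorial : ℝ) * m k
      = ∑' k : ℕ, (-s) ^ k * n k := by
  have hδ0 : 0 < δ := hs.trans hsδ
  have hKE : Integrable (fun x => ‖K x‖ * ‖E x‖) μ := by
    refine (hint 1 zero_le_one).mono' (hK.norm.mul hE.norm) (ae_of_all _ fun x => ?_)
    rw [Real.norm_of_nonneg (by positivity), one_mul]
    gcongr
    linarith [Real.add_one_le_exp ‖E x‖]
  -- the series in `y` is an integral
  have h1 : ∀ y : ℝ, 0 < y → ∑' k : ℕ, (-y) ^ k / (k.factorial : ℝ) * m k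
      = (∫ x, K x * E x * Complex.exp (-y * E x) ∂μ).im := by
    intro y hy
    have key : HasSum (fun k : ℕ => ∫ x, K x * E x * ((-y * E x) ^ k / (k.factorial : ℂ)) ∂μ)
        (∫ x, K x * E x * Complex.exp (-y * E x) ∂μ) := by
      refine hasSum_integral_of_dominated_convergence
        (fun k x => ‖K x‖ * ‖E x‖ * ((y * ‖E x‖) ^ k / (k.factorial : ℝ))) (fun k => ?_)
        (fun k => ae_of_all _ fun x => ?_) (ae_of_all _ fun x => ?_) ?_ (ae_of_all _ fun x => ?_)
      · have := (hE.const_mul (-y : ℂ)).pow k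
        exact (hK.mul hE).mul (by simpa [div_eq_mul_inv] using this.mul_const ((k.factorial : ℂ)⁻¹))
      · simp [abs_of_pos hy]
      · exact (Real.summable_pow_div_factorial _).mul_left _
      · have : (fun x => ∑' k : ℕ, ‖K x‖ * ‖E x‖ * ((y * ‖E x‖) ^ k / (k.factorial : ℝ)))
            = fun x => ‖K x‖ * ‖E x‖ * Real.exp (y * ‖E x‖) := by
          funext x
          rw [tsum_mul_left, Real.exp_eq_exp_ℝ, NormedSpace.exp_eq_tsum_div]
        rw [this]
        refine (hint (1 + y) (by positivity)).mono' ((hK.norm.mul hE.norm).mul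
          (Real.continuous_exp.comp_aestronglyMeasurable (hE.norm.const_mul y)))
          (ae_of_all _ fun x => ?_)
        rw [Real.norm_of_nonneg (by positivity), add_mul, Real.exp_add, mul_assoc, one_mul]
        gcongr
        linarith [Real.add_one_le_exp ‖E x‖]
      · rw [Complex.exp_eq_exp_ℂ]
        exact (NormedSpace.expSeries_div_hasSum_exp (-y * E x)).mul_left _
    have key2 := Complex.hasSum_im key
    rw [← key2.tsum_eq]
    congr 1
    funext k
    have : (∫ x, K x * E x * ((-y * E x) ^ k / (k.factorial : ℂ)) ∂μ)
        = (((-y) ^ k / (k.factorial : ℝ) : ℝ) : ℂ) * ∫ x, K x * E x ^ (k + 1) ∂μ := by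
      rw [← integral_const_mul]
      congr 1
      funext x
      push_cast
      rw [mul_pow]
      ring
    rw [this, Complex.im_ofReal_mul, hm]
  -- Fubini
  have hFint : Integrable (Function.uncurry fun (y : ℝ) (x : X) =>
      (Real.exp (-s * y) : ℂ) * (K x * E x * Complex.exp (-y * E x)))
      ((volume.restrict (Ioi (0 : ℝ))).prod μ) := by
    refine ((exp_neg_integrableOn_Ioi 0 hs).integrable.mul_prod hKE).mono' ?_ ?_
    · refine AEStronglyMeasurable.mul ?_ (AEStronglyMeasurable.mul ?_ ?_)
      · exact (Measurable.aestronglyMeasurable (by fun_prop))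
      · exact (hK.mul hE).comp_snd
      · refine Complex.continuous_exp.comp_aestronglyMeasurable
          (AEStronglyMeasurable.mul ?_ hE.comp_snd)
        exact (Measurable.aestronglyMeasurable (by fun_prop))
    · have hy : ∀ᵐ z ∂((volume.restrict (Ioi (0 : ℝ))).prod μ), 0 < z.1 :=
        Measure.quasiMeasurePreserving_fst.ae
          ((ae_restrict_iff' measurableSet_Ioi).2 (ae_of_all _ fun y hy => hy))
      have hx : ∀ᵐ z ∂((volume.restrict (Ioi (0 : ℝ))).prod μ), δ ≤ (E z.2).re :=
        Measure.quasiMeasurePreserving_snd.ae hδ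
      filter_upwards [hy, hx] with z hy hx
      have : ‖Complex.exp (-z.1 * E z.2)‖ ≤ 1 := by
        rw [Complex.norm_exp, Real.exp_le_one_iff, ← Complex.ofReal_neg, Complex.re_ofReal_mul]
        nlinarith
      simp only [Function.uncurry, norm_mul, Complex.norm_real, Real.norm_eq_abs, Real.abs_exp]
      exact mul_le_mul_of_nonneg_left (mul_le_of_le_one_right (by positivity) this)
        (by positivity)
  have h2 : ∫ y in Ioi (0 : ℝ), Real.exp (-s * y) * ∑' k : ℕ, (-y) ^ k / (k.factorial : ℝ) * m k
      = (∫ y in Ioi (0 : ℝ), ∫ x,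
          (Real.exp (-s * y) : ℂ) * (K x * E x * Complex.exp (-y * E x)) ∂μ).im := by
    have := integral_im hFint.integral_prod_left
    simp only [Function.uncurry, RCLike.im_to_complex] at this
    rw [← this]
    refine setIntegral_congr_fun measurableSet_Ioi fun y hy => ?_
    rw [h1 y hy, integral_const_mul, Complex.im_ofReal_mul]
  have h3 : ∀ᵐ x ∂μ, ∫ y in Ioi (0 : ℝ),
      (Real.exp (-s * y) : ℂ) * (K x * E x * Complex.exp (-y * E x)) = K x * (E x / (s + E x)) := by
    filter_upwards [hδ] with x hx
    have hre : (-(s + E x)).re < 0 := by simp; linarith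
    have hne : (s + E x) ≠ 0 := by
      intro h
      rw [h] at hre
      simp at hre
    have := integral_exp_mul_complex_Ioi hre 0
    simp only [Complex.ofReal_zero, mul_zero, Complex.exp_zero] at this
    calc _ = ∫ y in Ioi (0 : ℝ), (K x * E x) * Complex.exp (-(s + E x) * y) := by
          congr 1
          funext y
          rw [Complex.ofReal_exp, mul_left_comm, ← Complex.exp_add]
          congr 2
          push_cast
          ring
      _ = _ := by
          rw [integral_const_mul, this]
          field_simp
  rw [h2, integral_integral_swap hFint, integral_congr_ae h3]
  -- geometric expansion
  have hratio : s / δ < 1 := (div_lt_one hδ0).2 hsδ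
  have hKint : Integrable (fun x => ‖K x‖) μ := by simpa using hint 0 le_rfl
  have hnorm : ∀ᵐ x ∂μ, ‖-s * (E x)⁻¹‖ ≤ s / δ := by
    filter_upwards [hδ] with x hx
    have : δ ≤ ‖E x‖ := hx.trans (Complex.re_le_norm _)
    rw [norm_mul, norm_neg, norm_inv, Complex.norm_real, Real.norm_of_nonneg hs.le, div_eq_mul_inv]
    gcongr
  have key : HasSum (fun k : ℕ => ∫ x, K x * (-s * (E x)⁻¹) ^ k ∂μ)
      (∫ x, K x * (E x / (s + E x)) ∂μ) := by
    refine hasSum_integral_of_dominated_convergence (fun k x => ‖K x‖ * (s / δ) ^ k)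
      (fun k => ?_) (fun k => ?_) (ae_of_all _ fun x => ?_) ?_ ?_
    · exact hK.mul ((hE.inv₀.const_mul (-s : ℂ)).pow k)
    · filter_upwards [hnorm] with x hx
      rw [norm_mul, norm_pow]
      gcongr
    · exact (summable_geometric_of_lt_one (by positivity) hratio).mul_left _
    · simp_rw [tsum_mul_left]
      exact hKint.mul_const _
    · filter_upwards [hnorm, hδ] with x hx hx2
      have hE0 : E x ≠ 0 := by
        intro h
        rw [h] at hx2
        simp at hx2
        linarith
      have hne : (s + E x) ≠ 0 := by
        intro h
        have := congrArg Complex.re h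
        simp at this
        linarith
      have := (hasSum_geometric_of_norm_lt_one (hx.trans_lt hratio)).mul_left (K x)
      have heq : E x / (s + E x) = (1 - -s * (E x)⁻¹)⁻¹ := by
        have : 1 - -s * (E x)⁻¹ = (s + E x) / E x := by
          field_simp
          ring
        rw [this, inv_div]
      rwa [heq]
  rw [← (Complex.hasSum_im key).tsum_eq]
  congr 1
  funext k
  have : (∫ x, K x * (-s * (E x)⁻¹) ^ k ∂μ)
      = (((-s) ^ k : ℝ) : ℂ) * ∫ x, K x * (E x)⁻¹ ^ k ∂μ := by
    rw [← integral_const_mul]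
    congr 1
    funext x
    push_cast
    rw [mul_pow]
    ring
  rw [this, Complex.im_ofReal_mul, hn]

/-- The integrand `exp (exp z) * exp (a z)` of Hankel's integral for `1 / Γ(1 - a)`, in the
logarithmic coordinate `z = log u`. -/
noncomputable def hankelIntegrand (a : ℝ) (z : ℂ) : ℂ :=
  Complex.exp (Complex.exp z) * Complex.exp (a * z)

/-- The upper half of Hankel's contour in the logarithmic coordinate: up the segment from `L` to
`L + iψ` for `-ψ ≤ τ ≤ 0`, then along the horizontal half-line starting at `L + iψ`. -/
noncomputable def hankelPath (L ψ τ : ℝ) : ℂ := ⟨L + max τ 0, ψ + min τ 0⟩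

/-- The factor `exp (exp γ) * γ'` along the contour `γ = hankelPath L ψ`. -/
noncomputable def hankelKernel (L ψ τ : ℝ) : ℂ :=
  Complex.exp (Complex.exp (hankelPath L ψ τ)) * if τ ≤ 0 then Complex.I else 1

theorem continuous_hankelPath (L ψ : ℝ) : Continuous (hankelPath L ψ) := by
  have : hankelPath L ψ = fun τ : ℝ =>
      ((L + max τ 0 : ℝ) : ℂ) + ((ψ + min τ 0 : ℝ) : ℂ) * Complex.I := by
    funext τ
    apply Complex.ext <;> simp [hankelPath]
  rw [this]
  fun_prop

theorem measurable_hankelKernel (L ψ : ℝ) : Measurable (hankelKernel L ψ) := by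
  refine Measurable.mul ?_ (Measurable.ite measurableSet_Iic measurable_const measurable_const)
  have := continuous_hankelPath L ψ
  exact Continuous.measurable (by fun_prop)

theorem exists_forall_mul_exp_mul_le {β κ b : ℝ} (hβ0 : 0 < β) (hβ1 : β < 1) (hκ : 0 < κ)
    (hb : 0 ≤ b) :
    ∃ C : ℝ, ∀ ρ : ℝ, -κ * Real.exp ρ + b * Real.exp (β * ρ) ≤ C - κ / 2 * ρ := by
  have h1β : 0 < 1 - β := by linarith
  obtain ⟨ρ₀, hρ₀⟩ : ∃ ρ₀ : ℝ, b ≤ κ / 2 * Real.exp ((1 - β) * ρ₀) := by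
    refine ⟨(2 * b / κ) / (1 - β), ?_⟩
    rw [mul_div_cancel₀ _ h1β.ne']
    have := Real.add_one_le_exp (2 * b / κ)
    calc b = κ / 2 * (2 * b / κ) := by field_simp
      _ ≤ _ := by gcongr; linarith
  refine ⟨b * Real.exp (β * ρ₀), fun ρ => ?_⟩
  have h1 : b * Real.exp (β * ρ) ≤ κ / 2 * Real.exp ρ + b * Real.exp (β * ρ₀) := by
    rcases le_total ρ ρ₀ with h | h
    · have : b * Real.exp (β * ρ) ≤ b * Real.exp (β * ρ₀) := by gcongr
      have := Real.exp_pos ρ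
      nlinarith
    · have h2 : b * Real.exp (β * ρ) ≤ κ / 2 * Real.exp ((1 - β) * ρ) * Real.exp (β * ρ) := by
        gcongr
        exact hρ₀.trans (by gcongr)
      rw [mul_assoc, ← Real.exp_add, show (1 - β) * ρ + β * ρ = ρ by ring] at h2
      have := Real.exp_pos (β * ρ₀)
      nlinarith
  nlinarith [Real.add_one_le_exp ρ]

theorem mul_le_abs_mul_exp_half {a ρ : ℝ} (hρ : 0 ≤ ρ) :
    a * ρ ≤ 2 * |a| * Real.exp (1 / 2 * ρ) := by
  have h1 := Real.add_one_le_exp (1 / 2 * ρ)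
  calc a * ρ ≤ |a| * ρ := by gcongr; exact le_abs_self a
    _ = 2 * |a| * (1 / 2 * ρ) := by ring
    _ ≤ _ := by gcongr; linarith

theorem exists_forall_mul_le {κ a : ℝ} (hκ : 0 < κ) :
    ∃ C : ℝ, ∀ ρ : ℝ, 0 ≤ ρ → -κ * Real.exp ρ + a * ρ ≤ C - κ / 2 * ρ := by
  obtain ⟨C, hC⟩ := exists_forall_mul_exp_mul_le (β := 1 / 2) (b := 2 * |a|) (by norm_num)
    (by norm_num) hκ (by positivity)
  exact ⟨C, fun ρ hρ => by linarith [hC ρ, mul_le_abs_mul_exp_half (a := a) hρ]⟩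

theorem norm_hankelIntegrand (a x y : ℝ) :
    ‖hankelIntegrand a (x + y * Complex.I)‖ = Real.exp (Real.exp x * Real.cos y + a * x) := by
  simp [hankelIntegrand, Complex.norm_exp, Complex.exp_re, Real.exp_add]

theorem norm_hankelKernel_le {L ψ : ℝ} (hψ : Real.cos ψ < 0) (τ : ℝ) :
    ‖hankelKernel L ψ τ‖ ≤ Real.exp ((1 - Real.cos ψ) * Real.exp L) *
      Real.exp (Real.cos ψ * Real.exp (L + max τ 0)) := by
  have h : ‖(if τ ≤ 0 then Complex.I else 1 : ℂ)‖ = 1 := by split_ifs <;> simp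
  rw [hankelKernel, norm_mul, h, mul_one, Complex.norm_exp, Complex.exp_re, ← Real.exp_add,
    Real.exp_le_exp]
  simp only [hankelPath]
  have hL := Real.exp_pos L
  rcases le_total τ 0 with hτ | hτ
  · rw [max_eq_right hτ, add_zero]
    nlinarith [Real.cos_le_one (ψ + min τ 0)]
  · rw [min_eq_right hτ, add_zero]
    nlinarith

theorem integrableOn_hankelKernel_bound {L ψ β b : ℝ} (hψ : Real.cos ψ < 0) (hβ0 : 0 < β)
    (hβ1 : β < 1) (hb : 0 ≤ b) :
    IntegrableOn (fun τ => ‖hankelKernel L ψ τ‖ * Real.exp (b * Real.exp (β * (L + max τ 0))))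
      (Ioi (-ψ)) := by
  obtain ⟨C, hC⟩ := exists_forall_mul_exp_mul_le hβ0 hβ1 (neg_pos.2 hψ) hb
  have hb := (exp_neg_integrableOn_Ioi (-ψ) (b := -Real.cos ψ / 2) (by linarith)).const_mul
    (Real.exp ((1 - Real.cos ψ) * Real.exp L) * Real.exp (C + Real.cos ψ / 2 * L))
  refine hb.mono' ?_ (ae_of_all _ fun τ => ?_)
  · refine Measurable.aestronglyMeasurable ?_
    have := measurable_hankelKernel L ψ
    fun_prop
  · rw [Real.norm_of_nonneg (by positivity)]
    calc _ ≤ Real.exp ((1 - Real.cos ψ) * Real.exp L) *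
            Real.exp (Real.cos ψ * Real.exp (L + max τ 0)) *
            Real.exp (b * Real.exp (β * (L + max τ 0))) := by
          gcongr
          exact norm_hankelKernel_le hψ τ
      _ ≤ _ := by
          simp only [← Real.exp_add, Real.exp_le_exp]
          have := hC (L + max τ 0)
          nlinarith [le_max_left τ 0]

theorem norm_exp_hankelPath (a L ψ τ : ℝ) :
    ‖Complex.exp (a * hankelPath L ψ τ)‖ = Real.exp (a * (L + max τ 0)) := by
  rw [Complex.norm_exp, Complex.re_ofReal_mul]
  rfl

theorem norm_hankelKernel_mul_exp_le {a A L ψ τ : ℝ} (hL : 0 ≤ L) (ha : |a| ≤ A) :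
    ‖hankelKernel L ψ τ * Complex.exp (a * hankelPath L ψ τ)‖ ≤
      ‖hankelKernel L ψ τ‖ * Real.exp (2 * A * Real.exp (1 / 2 * (L + max τ 0))) := by
  rw [norm_mul, norm_exp_hankelPath]
  refine mul_le_mul_of_nonneg_left (Real.exp_le_exp.2 ?_) (norm_nonneg _)
  refine (mul_le_abs_mul_exp_half (add_nonneg hL (le_max_right τ 0))).trans ?_
  gcongr

theorem aestronglyMeasurable_hankelKernel_mul_exp (a L ψ : ℝ) (μ : Measure ℝ) :
    AEStronglyMeasurable
      (fun τ => hankelKernel L ψ τ * Complex.exp (a * hankelPath L ψ τ)) μ := by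
  have h := (continuous_hankelPath L ψ).measurable
  have := measurable_hankelKernel L ψ
  exact Measurable.aestronglyMeasurable (by fun_prop)

theorem integrableOn_hankelKernel_mul_exp {L ψ : ℝ} (hL : 0 ≤ L) (hψ : Real.cos ψ < 0) (a : ℝ) :
    IntegrableOn (fun τ => hankelKernel L ψ τ * Complex.exp (a * hankelPath L ψ τ))
      (Ioi (-ψ)) :=
  (integrableOn_hankelKernel_bound (β := 1 / 2) (b := 2 * |a|) hψ (by norm_num) (by norm_num)
    (by positivity)).mono' (aestronglyMeasurable_hankelKernel_mul_exp a L ψ _)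
    (ae_of_all _ fun _ => norm_hankelKernel_mul_exp_le hL le_rfl)

/-- The integral over the upper half of Hankel's contour. -/
noncomputable def hankelIntegral (L ψ a : ℝ) : ℂ :=
  ∫ τ in Ioi (-ψ), hankelKernel L ψ τ * Complex.exp (a * hankelPath L ψ τ)

theorem continuous_hankelIntegral {L ψ : ℝ} (hL : 0 ≤ L) (hψ : Real.cos ψ < 0) :
    Continuous (hankelIntegral L ψ) := by
  refine continuous_iff_continuousAt.2 fun a₀ => ?_
  unfold hankelIntegral
  refine continuousAt_of_dominated
    (Eventually.of_forall fun a => aestronglyMeasurable_hankelKernel_mul_exp a L ψ _) ?_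
    (integrableOn_hankelKernel_bound (L := L) (β := 1 / 2) (b := 2 * (|a₀| + 1)) hψ (by norm_num)
      (by norm_num) (by positivity)) (ae_of_all _ fun τ => ?_)
  · have : ∀ᶠ a in nhds a₀, |a| < |a₀| + 1 :=
      continuous_abs.continuousAt.eventually_lt continuousAt_const (by simp)
    filter_upwards [this] with a ha
    exact ae_of_all _ fun τ => norm_hankelKernel_mul_exp_le hL ha.le
  · exact Continuous.continuousAt (by fun_prop)

theorem continuous_hankelIntegrand (a : ℝ) : Continuous (hankelIntegrand a) := by
  unfold hankelIntegrand
  fun_prop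

theorem integrableOn_hankelIntegrand_Ioi {ψ : ℝ} (hψ : Real.cos ψ < 0) (a L : ℝ) (hL : 0 ≤ L) :
    IntegrableOn (fun x : ℝ => hankelIntegrand a (x + ψ * Complex.I)) (Ioi L) := by
  obtain ⟨C, hC⟩ := exists_forall_mul_le (a := a) (neg_pos.2 hψ)
  have hb := (exp_neg_integrableOn_Ioi L (b := -Real.cos ψ / 2) (by linarith)).const_mul
    (Real.exp C)
  have := continuous_hankelIntegrand a
  refine hb.mono' (Continuous.aestronglyMeasurable (by fun_prop))
    ((ae_restrict_iff' measurableSet_Ioi).2 (ae_of_all _ fun x hx => ?_))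
  rw [norm_hankelIntegrand, ← Real.exp_add, Real.exp_le_exp]
  linarith [hC x (hL.trans (le_of_lt hx))]

theorem hankelIntegral_eq {L ψ : ℝ} (hL : 0 ≤ L) (hψ0 : 0 ≤ ψ) (hψ : Real.cos ψ < 0) (a : ℝ) :
    hankelIntegral L ψ a =
      Complex.I * (∫ y in (0 : ℝ)..ψ, hankelIntegrand a (L + y * Complex.I)) +
      ∫ x in Ioi L, hankelIntegrand a (x + ψ * Complex.I) := by
  have hint := integrableOn_hankelKernel_mul_exp hL hψ a
  rw [hankelIntegral, ← intervalIntegral.integral_interval_add_Ioi hint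
    (hint.mono_set (Ioi_subset_Ioi (neg_nonpos.2 hψ0)))]
  congr 1
  · have h := intervalIntegral.integral_comp_add_right (a := -ψ) (b := 0)
      (fun y : ℝ => Complex.I * hankelIntegrand a (L + y * Complex.I)) ψ
    rw [neg_add_cancel, zero_add] at h
    rw [← intervalIntegral.integral_const_mul, ← h]
    refine intervalIntegral.integral_congr fun τ hτ => ?_
    rw [uIcc_of_le (neg_nonpos.2 hψ0)] at hτ
    have hp : hankelPath L ψ τ = L + (τ + ψ : ℝ) * Complex.I := by
      apply Complex.ext <;> simp [hankelPath, hτ.2, add_comm]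
    simp only [hankelKernel, hp, if_pos hτ.2, hankelIntegrand]
    ring
  · have h := (measurePreserving_add_right volume L).setIntegral_preimage_emb
      (measurableEmbedding_addRight L)
      (fun x : ℝ => hankelIntegrand a (x + ψ * Complex.I)) (Ioi L)
    rw [preimage_add_const_Ioi, sub_self] at h
    rw [← h]
    refine setIntegral_congr_fun measurableSet_Ioi fun τ hτ => ?_
    have hτ : 0 < τ := hτ
    have hp : hankelPath L ψ τ = (τ + L : ℝ) + ψ * Complex.I := by
      apply Complex.ext <;> simp [hankelPath, hτ.le, add_comm]
    simp only [hankelKernel, hp, if_neg hτ.not_ge, hankelIntegrand]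
    ring

theorem hasDerivAt_hankelIntegrand (a : ℝ) (z : ℂ) :
    HasDerivAt (hankelIntegrand a) (hankelIntegrand (a + 1) z + a * hankelIntegrand a z) z := by
  have h1 : HasDerivAt (fun z => Complex.exp (Complex.exp z))
      (Complex.exp (Complex.exp z) * Complex.exp z) z := (Complex.hasDerivAt_exp z).cexp
  have h2 : HasDerivAt (fun z => Complex.exp (a * z)) (Complex.exp (a * z) * (a * 1)) z :=
    ((hasDerivAt_id z).const_mul (a : ℂ)).cexp
  refine (h1.mul h2).congr_deriv ?_
  unfold hankelIntegrand
  push_cast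
  rw [add_mul, Complex.exp_add, one_mul]
  ring

theorem differentiable_hankelIntegrand (a : ℝ) : Differentiable ℂ (hankelIntegrand a) :=
  fun z => (hasDerivAt_hankelIntegrand a z).differentiableAt

theorem hankelIntegrand_ofReal_im (a x : ℝ) : (hankelIntegrand a x).im = 0 := by
  rw [hankelIntegrand, ← Complex.ofReal_exp, ← Complex.ofReal_exp, ← Complex.ofReal_mul,
    ← Complex.ofReal_exp, ← Complex.ofReal_mul, Complex.ofReal_im]

theorem tendsto_hankelIntegrand_atTop {ψ : ℝ} (hψ : Real.cos ψ < 0) (a : ℝ) :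
    Tendsto (fun x : ℝ => hankelIntegrand a (x + ψ * Complex.I)) atTop (nhds 0) := by
  obtain ⟨C, hC⟩ := exists_forall_mul_le (a := a) (neg_pos.2 hψ)
  have hlim : Tendsto (fun x : ℝ => Real.exp (C + Real.cos ψ / 2 * x)) atTop (nhds 0) :=
    Real.tendsto_exp_atBot.comp (tendsto_atBot_add_const_left _ C
      (tendsto_id.const_mul_atTop_of_neg (by linarith)))
  refine squeeze_zero_norm' ?_ hlim
  filter_upwards [eventually_ge_atTop 0] with x hx
  rw [norm_hankelIntegrand, Real.exp_le_exp]
  linarith [hC x hx]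

theorem hankelIntegral_add_one_im {L ψ : ℝ} (hL : 0 ≤ L) (hψ0 : 0 ≤ ψ) (hψ : Real.cos ψ < 0)
    (a : ℝ) : (hankelIntegral L ψ (a + 1)).im = -a * (hankelIntegral L ψ a).im := by
  have hc := continuous_hankelIntegrand
  have harc : Complex.I * (∫ y in (0 : ℝ)..ψ, hankelIntegrand (a + 1) (L + y * Complex.I)) +
      a * (Complex.I * (∫ y in (0 : ℝ)..ψ, hankelIntegrand a (L + y * Complex.I))) =
      hankelIntegrand a (L + ψ * Complex.I) - hankelIntegrand a L := by
    have h := intervalIntegral.integral_eq_sub_of_hasDerivAt (a := 0) (b := ψ)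
      (f := fun y : ℝ => hankelIntegrand a (L + y * Complex.I))
      (f' := fun y : ℝ => Complex.I * hankelIntegrand (a + 1) (L + y * Complex.I) +
        a * (Complex.I * hankelIntegrand a (L + y * Complex.I)))
      (fun y _ => by
        have h1 : HasDerivAt (fun y : ℝ => (L + y * Complex.I : ℂ)) (1 * Complex.I) y :=
          ((Complex.ofRealCLM.hasDerivAt (x := y)).mul_const Complex.I).const_add (L : ℂ)
        refine ((hasDerivAt_hankelIntegrand a (L + y * Complex.I)).comp y h1).congr_deriv ?_
        ring)
      (Continuous.intervalIntegrable (by fun_prop) _ _)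
    rw [intervalIntegral.integral_add (Continuous.intervalIntegrable (by fun_prop) _ _)
      (Continuous.intervalIntegrable (by fun_prop) _ _), intervalIntegral.integral_const_mul,
      intervalIntegral.integral_const_mul, intervalIntegral.integral_const_mul] at h
    simpa using h
  have hray : (∫ x in Ioi L, hankelIntegrand (a + 1) (x + ψ * Complex.I)) +
      a * (∫ x in Ioi L, hankelIntegrand a (x + ψ * Complex.I)) =
      -hankelIntegrand a (L + ψ * Complex.I) := by
    have i1 := integrableOn_hankelIntegrand_Ioi hψ (a + 1) L hL
    have i2 := (integrableOn_hankelIntegrand_Ioi hψ a L hL).const_mul (a : ℂ)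
    rw [← integral_const_mul]
    refine (integral_add i1 i2).symm.trans ?_
    refine (integral_Ioi_of_hasDerivAt_of_tendsto
      (f := fun x : ℝ => hankelIntegrand a (x + ψ * Complex.I))
      (Continuous.continuousWithinAt (by fun_prop)) (fun x _ => ?_) (i1.add i2)
      (tendsto_hankelIntegrand_atTop hψ a)).trans (zero_sub _)
    have h1 : HasDerivAt (fun x : ℝ => (x + ψ * Complex.I : ℂ)) 1 x :=
      (Complex.ofRealCLM.hasDerivAt (x := x)).add_const _
    exact ((hasDerivAt_hankelIntegrand a (x + ψ * Complex.I)).comp x h1).congr_deriv (mul_one _)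
  have hsum : hankelIntegral L ψ (a + 1) + a * hankelIntegral L ψ a = -hankelIntegrand a L := by
    rw [hankelIntegral_eq hL hψ0 hψ, hankelIntegral_eq hL hψ0 hψ]
    linear_combination harc + hray
  have := congrArg Complex.im hsum
  rw [Complex.add_im, Complex.im_ofReal_mul, Complex.neg_im, hankelIntegrand_ofReal_im] at this
  linarith

theorem hankelIntegrand_rect (a p q y₁ y₂ : ℝ) :
    (∫ x in p..q, hankelIntegrand a (x + y₁ * Complex.I)) -
      (∫ x in p..q, hankelIntegrand a (x + y₂ * Complex.I)) +
      Complex.I * (∫ y in y₁..y₂, hankelIntegrand a (q + y * Complex.I)) -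
      Complex.I * (∫ y in y₁..y₂, hankelIntegrand a (p + y * Complex.I)) = 0 := by
  simpa using Complex.integral_boundary_rect_eq_zero_of_differentiableOn (hankelIntegrand a)
    (⟨p, y₁⟩ : ℂ) (⟨q, y₂⟩ : ℂ) (differentiable_hankelIntegrand a).differentiableOn

theorem tendsto_integral_hankelIntegrand_neg {a : ℝ} (ha : 0 < a) (y₁ y₂ : ℝ) :
    Tendsto (fun T : ℝ => ∫ y in y₁..y₂, hankelIntegrand a ((-T : ℝ) + y * Complex.I)) atTop
      (nhds 0) := by
  have hlim : Tendsto (fun T : ℝ => Real.exp (1 + -a * T) * |y₂ - y₁|) atTop (nhds 0) := by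
    have := (Real.tendsto_exp_atBot.comp (tendsto_atBot_add_const_left _ 1
      ((tendsto_id (α := ℝ)).const_mul_atTop_of_neg (neg_lt_zero.2 ha)))).mul_const |y₂ - y₁|
    simpa using this
  refine squeeze_zero_norm' ?_ hlim
  filter_upwards [eventually_ge_atTop 0] with T hT
  refine intervalIntegral.norm_integral_le_of_norm_le_const fun y _ => ?_
  rw [norm_hankelIntegrand, Real.exp_le_exp]
  have h1 : Real.exp (-T) ≤ 1 := Real.exp_le_one_iff.2 (by linarith)
  have h2 := Real.cos_le_one y
  nlinarith [Real.exp_pos (-T)]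

theorem tendsto_integral_hankelIntegrand_atTop {ψ : ℝ} (hψ0 : 0 ≤ ψ) (hψπ : ψ ≤ π)
    (hψ : Real.cos ψ < 0) (a : ℝ) :
    Tendsto (fun T : ℝ => ∫ y in ψ..π, hankelIntegrand a (T + y * Complex.I)) atTop
      (nhds 0) := by
  have hlim := (tendsto_hankelIntegrand_atTop hψ a).norm.mul_const |π - ψ|
  rw [norm_zero, zero_mul] at hlim
  refine squeeze_zero_norm (fun T => ?_) hlim
  refine intervalIntegral.norm_integral_le_of_norm_le_const fun y hy => ?_
  rw [uIoc_of_le hψπ] at hy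
  rw [norm_hankelIntegrand, norm_hankelIntegrand, Real.exp_le_exp]
  have := Real.cos_le_cos_of_nonneg_of_le_pi hψ0 hy.2 hy.1.le
  gcongr

theorem integrable_hankelIntegrand {a ψ : ℝ} (ha : 0 < a) (hψ : Real.cos ψ < 0) :
    Integrable (fun x : ℝ => hankelIntegrand a (x + ψ * Complex.I)) := by
  have hc := continuous_hankelIntegrand a
  rw [← integrableOn_univ, ← Iic_union_Ioi (a := (0 : ℝ))]
  refine IntegrableOn.union ?_ (integrableOn_hankelIntegrand_Ioi hψ a 0 le_rfl)
  refine (integrableOn_exp_mul_Iic ha 0).mono' (Continuous.aestronglyMeasurable (by fun_prop))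
    (ae_of_all _ fun x => ?_)
  rw [norm_hankelIntegrand, Real.exp_le_exp]
  nlinarith [Real.exp_pos x]

theorem integral_hankelIntegrand_pi {a : ℝ} (ha : 0 < a) :
    ∫ x : ℝ, hankelIntegrand a (x + π * Complex.I) =
      Complex.exp (a * (π * Complex.I)) * (Real.Gamma a : ℂ) := by
  have h := integral_image_eq_integral_abs_deriv_smul MeasurableSet.univ
    (fun x _ => (Real.hasDerivAt_exp x).hasDerivWithinAt) Real.exp_injective.injOn
    (fun r : ℝ => Real.exp (-r) * r ^ (a - 1))
  rw [image_univ, Real.range_exp, setIntegral_univ] at h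
  rw [Real.Gamma_eq_integral ha, h, ← integral_complex_ofReal, ← integral_const_mul]
  congr 1
  funext x
  rw [hankelIntegrand, Complex.exp_add, Complex.exp_pi_mul_I, mul_add, Complex.exp_add,
    abs_of_pos (Real.exp_pos x), ← Real.exp_mul, smul_eq_mul, mul_left_comm, ← Real.exp_add]
  push_cast
  simp only [← Complex.exp_add]
  congr 1
  ring

theorem integral_hankelIntegrand {a ψ : ℝ} (ha : 0 < a) (hψ0 : 0 ≤ ψ) (hψπ : ψ ≤ π)
    (hψ : Real.cos ψ < 0) :
    ∫ x : ℝ, hankelIntegrand a (x + ψ * Complex.I) =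
      ∫ x : ℝ, hankelIntegrand a (x + π * Complex.I) := by
  have h1 := intervalIntegral_tendsto_integral (integrable_hankelIntegrand ha hψ)
    tendsto_neg_atTop_atBot tendsto_id
  have h2 := intervalIntegral_tendsto_integral
    (integrable_hankelIntegrand ha (by simp : Real.cos π < 0)) tendsto_neg_atTop_atBot tendsto_id
  have h3 := (tendsto_integral_hankelIntegrand_atTop hψ0 hψπ hψ a).const_mul Complex.I
  have h4 := (tendsto_integral_hankelIntegrand_neg ha ψ π).const_mul Complex.I
  have h5 := ((h1.sub h2).add h3).sub h4
  have h6 := tendsto_nhds_unique h5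
    (tendsto_const_nhds.congr fun T => (hankelIntegrand_rect a (-T) T ψ π).symm)
  simpa [sub_eq_zero] using h6

theorem hankelIntegral_im_of_pos {a L ψ : ℝ} (ha : 0 < a) (hL : 0 ≤ L) (hψ0 : 0 ≤ ψ)
    (hψπ : ψ ≤ π) (hψ : Real.cos ψ < 0) :
    (hankelIntegral L ψ a).im = π / Real.Gamma (1 - a) := by
  have hint := integrable_hankelIntegrand ha hψ
  have h1 := intervalIntegral_tendsto_integral_Iic L hint.integrableOn tendsto_neg_atTop_atBot
  have h4 := (tendsto_integral_hankelIntegrand_neg ha 0 ψ).const_mul Complex.I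
  have h5 := ((Complex.continuous_im.tendsto _).comp (h1.add h4)).congr
    (f₂ := fun _ => (Complex.I * ∫ y in (0 : ℝ)..ψ, hankelIntegrand a (L + y * Complex.I)).im)
    fun T => by
      have h := congrArg Complex.im (hankelIntegrand_rect a (-T) L 0 ψ)
      have h0 : (∫ x in (-T)..L, hankelIntegrand a (x + (0 : ℝ) * Complex.I)).im = 0 := by
        have hc := continuous_hankelIntegrand a
        have := Complex.imCLM.intervalIntegral_comp_comm
          (Continuous.intervalIntegrable (μ := volume)
            (by fun_prop : Continuous fun x : ℝ => hankelIntegrand a (x + (0 : ℝ) * Complex.I))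
            (-T) L)
        simp only [Complex.imCLM_apply] at this
        rw [← this]
        simp [hankelIntegrand_ofReal_im]
      rw [Complex.sub_im, Complex.add_im, Complex.sub_im, h0, Complex.zero_im] at h
      rw [Function.comp_apply, Complex.add_im]
      linarith
  have h6 := tendsto_nhds_unique h5 tendsto_const_nhds
  rw [mul_zero, add_zero] at h6
  rw [hankelIntegral_eq hL hψ0 hψ, Complex.add_im, ← h6, ← Complex.add_im,
    intervalIntegral.integral_Iic_add_Ioi hint.integrableOn hint.integrableOn,
    integral_hankelIntegrand ha hψ0 hψπ hψ, integral_hankelIntegrand_pi ha, ← mul_assoc,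
    ← Complex.ofReal_mul, Complex.im_mul_ofReal, Complex.exp_ofReal_mul_I_im]
  have hG := Real.Gamma_mul_Gamma_one_sub a
  rw [mul_comm a π]
  rcases eq_or_ne (Real.sin (π * a)) 0 with hs | hs
  · rw [hs, div_zero] at hG
    rw [hs, zero_mul, (mul_eq_zero.1 hG).resolve_left (Real.Gamma_pos_of_pos ha).ne', div_zero]
  · have : Real.Gamma (1 - a) ≠ 0 := by
      intro h
      rw [h, mul_zero, eq_comm, div_eq_zero_iff] at hG
      exact hG.elim Real.pi_ne_zero hs
    rw [eq_div_iff hs] at hG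
    rw [eq_div_iff this]
    linarith

/-- Hankel's formula for the reciprocal Gamma function, on the real line. -/
theorem hankelIntegral_im {L ψ : ℝ} (hL : 0 ≤ L) (hψ0 : 0 ≤ ψ) (hψπ : ψ ≤ π)
    (hψ : Real.cos ψ < 0) (a : ℝ) :
    (hankelIntegral L ψ a).im = π / Real.Gamma (1 - a) := by
  have hzero : (hankelIntegral L ψ 0).im = π / Real.Gamma (1 - 0) := by
    have h1 : Tendsto (fun a => (hankelIntegral L ψ a).im) (nhdsWithin 0 (Ioi 0))
        (nhds (hankelIntegral L ψ 0).im) :=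
      ((Complex.continuous_im.comp (continuous_hankelIntegral hL hψ)).tendsto 0).mono_left
        nhdsWithin_le_nhds
    have hG : ContinuousAt Real.Gamma (1 - 0) := (Real.differentiableAt_Gamma fun m => by
      have : (0 : ℝ) ≤ m := m.cast_nonneg
      linarith).continuousAt
    have h2 : ContinuousAt (fun a : ℝ => π / Real.Gamma (1 - a)) 0 :=
      continuousAt_const.div (ContinuousAt.comp (f := fun a : ℝ => 1 - a) hG (by fun_prop))
        (by simp)
    refine tendsto_nhds_unique h1 ((h2.tendsto.mono_left nhdsWithin_le_nhds).congr' ?_)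
    filter_upwards [self_mem_nhdsWithin] with b hb
    exact (hankelIntegral_im_of_pos hb hL hψ0 hψπ hψ).symm
  have hind : ∀ (n : ℕ) (a : ℝ), -n < a → (hankelIntegral L ψ a).im = π / Real.Gamma (1 - a) := by
    intro n
    induction n with
    | zero => exact fun a ha => hankelIntegral_im_of_pos (by simpa using ha) hL hψ0 hψπ hψ
    | succ n ih =>
      intro a ha
      rcases eq_or_ne a 0 with rfl | ha0
      · exact hzero
      · have h1 := ih (a + 1) (by push_cast at ha; linarith)
        rw [hankelIntegral_add_one_im hL hψ0 hψ, show 1 - (a + 1) = -a by ring] at h1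
        rw [show 1 - a = -a + 1 by ring, Real.Gamma_add_one (neg_ne_zero.2 ha0), mul_comm,
          ← div_div, ← h1, mul_div_cancel_left₀ _ (neg_ne_zero.2 ha0)]
  obtain ⟨n, hn⟩ := exists_nat_gt (-a)
  exact hind n a (by linarith)

/-- Laplace transform of `g_β(·;t)` in its first argument:
`∫_0^∞ e^{−s x} g_β(x;t) dx = E_β(−s t^β)`. -/
theorem wrightG_laplace_first_arg (β t s : ℝ) (hβ0 : 0 < β) (hβ1 : β < 1)
    (ht : 0 < t) (hs : 0 < s) :
    ∫ x in Set.Ioi (0:ℝ), Real.exp (-s * x) * wrightG β x t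
      = mittagLeffler β 1 (-s * t ^ β) := by
  have hc0 : 0 < t ^ (-β) := Real.rpow_pos_of_pos ht _
  have hcinv : t ^ (-β) = (t ^ β)⁻¹ := Real.rpow_neg ht.le β
  have htβ : 0 < t ^ β := Real.rpow_pos_of_pos ht _
  obtain ⟨ψ, hψ2, hψπ, hβψ⟩ : ∃ ψ : ℝ, π / 2 < ψ ∧ ψ < π ∧ β * ψ < π / 2 := by
    have hπ := Real.pi_pos
    refine ⟨π / (1 + β), ?_, ?_, ?_⟩
    · exact div_lt_div_of_pos_left hπ (by linarith) (by linarith)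
    · exact div_lt_self hπ (by linarith)
    · rw [mul_div_assoc', div_lt_div_iff₀ (by linarith) two_pos]
      nlinarith
  have hψ0 : 0 ≤ ψ := by linarith [Real.pi_pos]
  have hcos : Real.cos ψ < 0 := Real.cos_neg_of_pi_div_two_lt_of_lt hψ2 (by linarith)
  have hcosβ : 0 < Real.cos (β * ψ) :=
    Real.cos_pos_of_mem_Ioo ⟨by linarith [Real.pi_pos, mul_nonneg hβ0.le hψ0], hβψ⟩
  obtain ⟨L, hL, hsL⟩ : ∃ L : ℝ, 0 ≤ L ∧
      s < t ^ (-β) * (Real.exp (β * L) * Real.cos (β * ψ)) := by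
    refine ⟨s * t ^ β / Real.cos (β * ψ) / β, by positivity, ?_⟩
    rw [mul_div_cancel₀ _ hβ0.ne', hcinv, inv_mul_eq_div, lt_div_iff₀ htβ, ← div_lt_iff₀ hcosβ]
    linarith [Real.add_one_le_exp (s * t ^ β / Real.cos (β * ψ))]
  have hmoment : ∀ a c : ℝ, (∫ τ in Ioi (-ψ), ((π⁻¹ * c : ℝ) : ℂ) *
      (hankelKernel L ψ τ * Complex.exp (a * hankelPath L ψ τ))).im = c / Real.Gamma (1 - a) := by
    intro a c
    rw [integral_const_mul, Complex.im_ofReal_mul]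
    change _ * (hankelIntegral L ψ a).im = _
    rw [hankelIntegral_im hL hψ0 hψπ.le hcos]
    field_simp [Real.pi_ne_zero]
  have hγ := (continuous_hankelPath L ψ).measurable
  have hκ := measurable_hankelKernel L ψ
  have key := laplace_tsum_eq_tsum_inv (μ := volume.restrict (Ioi (-ψ)))
    (K := fun τ => ((π⁻¹ : ℝ) : ℂ) * hankelKernel L ψ τ)
    (E := fun τ => ((t ^ (-β) : ℝ) : ℂ) * Complex.exp (β * hankelPath L ψ τ))
    (Measurable.aestronglyMeasurable (by fun_prop))
    (Measurable.aestronglyMeasurable (by fun_prop)) hs hsL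
    (m := fun k => (t ^ (-β)) ^ (k + 1) / Real.Gamma (1 - β * (k + 1)))
    (n := fun k => (t ^ β) ^ k / Real.Gamma (1 - -(β * k)))
    ((ae_restrict_iff' measurableSet_Ioi).2 (ae_of_all _ fun τ hτ => ?_)) (fun b hb => ?_)
    (fun k => ?_) (fun k => ?_)
  · convert key using 1
    · refine setIntegral_congr_fun measurableSet_Ioi fun x _ => ?_
      simp only [wrightG]
      rw [← tsum_mul_left]
      congr 2
      funext k
      rw [hcinv, div_pow, pow_succ, inv_pow]
      field_simp
    · rw [mittagLeffler]
      congr 1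
      funext k
      rw [mul_pow, sub_neg_eq_add, add_comm 1, mul_div_assoc]
  · have hτ : -ψ < τ := hτ
    have hmin : 0 ≤ ψ + min τ 0 := by
      rcases le_total τ 0 with h | h
      · rw [min_eq_left h]; linarith
      · rw [min_eq_right h]; linarith
    rw [Complex.re_ofReal_mul, Complex.exp_re, Complex.re_ofReal_mul, Complex.im_ofReal_mul]
    simp only [hankelPath]
    have h1 : Real.cos (β * ψ) ≤ Real.cos (β * (ψ + min τ 0)) := by
      refine Real.cos_le_cos_of_nonneg_of_le_pi (by positivity) (by linarith [Real.pi_pos]) ?_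
      gcongr
      linarith [min_le_right τ 0]
    have h2 : L ≤ L + max τ 0 := by linarith [le_max_right τ 0]
    gcongr
  · refine ((integrableOn_hankelKernel_bound (L := L) hcos hβ0 hβ1
      (mul_nonneg hb hc0.le)).const_mul π⁻¹).congr (ae_of_all _ fun τ => ?_)
    simp only [norm_mul, norm_exp_hankelPath, Complex.norm_real, Real.norm_eq_abs,
      abs_of_pos hc0, abs_of_pos (inv_pos.2 Real.pi_pos)]
    ring_nf
  · rw [← hmoment]
    congr 2
    funext τ
    rw [mul_pow, ← Complex.exp_nat_mul]
    push_cast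
    ring_nf
  · rw [← hmoment]
    congr 2
    funext τ
    rw [mul_inv, mul_pow, ← Complex.exp_neg, ← Complex.exp_nat_mul, ← Complex.ofReal_inv, hcinv,
      inv_inv]
    push_cast
    ring_nf
end
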